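/- Currents are ratios of affine functions of the pinned rates: for every ordered pair e = (u,v) of distinct vertices there exist real numbers n₀, n₊, n₋, d₀, d₊, d₋, independent of p and m, with d₀ > 0 and d₊, d₋ ≥ 0, such that j_e(p,m) = (n₀ + n₊·p + n₋·m) / (d₀ + d₊·p + d₋·m) for all p, m ≥ 0; moreover for the input current itself one can take the numerator constant term to vanish: j_1(p,m) = (n₊·p + n₋·m) / (d₀ + d₊·p + d₋·m) with n₊ = τ_a^{∖{+1,−1}} and n₋ = −τ_b^{∖{+1,−1}} (here +1 := (a,b), −1 := (b,a)). -/

import Mathlib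

open scoped Classical

noncomputable section

/-- A rooted spanning tree with root `x`: a map `t : X → X` fixing `x` such that every
vertex reaches `x` under iteration of `t`. -/
def IsRootedTree {X : Type*} (x : X) (t : X → X) : Prop :=
  t x = x ∧ ∀ y : X, ∃ n : ℕ, t^[n] y = x

/-- The edge set of a rooted spanning tree: `{(y, t y) : y ≠ x}`. -/
def treeEdges {X : Type*} (x : X) (t : X → X) : Set (X × X) :=
  {p : X × X | p.1 ≠ x ∧ p.2 = t p.1}

/-- The weight of a rooted spanning tree: `∏_{y ≠ x} r (y, t y)`. -/
def treeWeight {X : Type*} [Fintype X] (r : X × X → ℝ) (x : X) (t : X → X) : ℝ :=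
  ∏ y ∈ Finset.univ.filter (fun y => y ≠ x), r (y, t y)

/-- The conditioned rooted spanning-tree polynomial `τ_x^{∖A ∥B}`: the sum of weights of
rooted spanning trees with root `x` avoiding all edges of `A` and containing all edges of `B`. -/
def tau {X : Type*} [Fintype X] (r : X × X → ℝ) (x : X) (A B : Set (X × X)) : ℝ :=
  ∑ t : X → X,
    if IsRootedTree x t ∧ treeEdges x t ∩ A = ∅ ∧ B ⊆ treeEdges x t
    then treeWeight r x t else 0

/-- Irreducibility: between any two distinct vertices there is a directed path of
present (positive-rate) edges. -/
def Irreducible' {X : Type*} (r : X × X → ℝ) : Prop :=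
  ∀ x y : X, x ≠ y → ∃ (n : ℕ) (f : ℕ → X),
    f 0 = x ∧ f n = y ∧ ∀ i < n, 0 < r (f i, f (i + 1))

/-- The rate function with the pinned rates `r(a,b) = p` and `r(b,a) = m` substituted. -/
def ratePM {X : Type*} (r : X × X → ℝ) (a b : X) (p m : ℝ) : X × X → ℝ :=
  fun e => if e = (a, b) then p else if e = (b, a) then m else r e

/-- The stationary current through the ordered pair `(u,v)`:
`(r(u,v) τ_u − r(v,u) τ_v) / Σ_x τ_x`. -/
def current {X : Type*} [Fintype X] (r : X × X → ℝ) (u v : X) : ℝ :=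
  (r (u, v) * tau r u ∅ ∅ - r (v, u) * tau r v ∅ ∅) / ∑ x, tau r x ∅ ∅

lemma ratePM_nonneg {X : Type*} (r : X × X → ℝ) (a b : X)
    (hr : ∀ e, e ≠ (a, b) → e ≠ (b, a) → 0 ≤ r e) (e : X × X) : 0 ≤ ratePM r a b 0 0 e := by
  unfold ratePM
  split_ifs with h1 h2
  · exact le_rfl
  · exact le_rfl
  · exact hr e h1 h2

lemma ratePM_swap {X : Type*} (r : X × X → ℝ) (a b : X) (hab : a ≠ b) (p m : ℝ) :
    ratePM r a b p m = ratePM r b a m p := by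
  funext e
  unfold ratePM
  by_cases h1 : e = (a, b)
  · have h2 : e ≠ (b, a) := by
      rw [h1]; intro h; exact hab (Prod.mk.inj h).1
    simp [h1, hab]
  · simp [h1]

lemma ratePM_off {X : Type*} (r : X × X → ℝ) (a b : X) (p m : ℝ) (e : X × X)
    (h1 : e ≠ (a, b)) (h2 : e ≠ (b, a)) : ratePM r a b p m e = r e := by
  simp [ratePM, h1, h2]

lemma not_both {X : Type*} (a b : X) (hab : a ≠ b) (x : X) (t : X → X)
    (ht : IsRootedTree x t) (ha : a ≠ x) (hta : t a = b) : ¬ (b ≠ x ∧ t b = a) := by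
  rintro ⟨hb, htb⟩
  obtain ⟨n, hn⟩ := ht.2 a
  have key : ∀ n : ℕ, t^[n] a = a ∨ t^[n] a = b := by
    intro n
    induction n with
    | zero => left; rfl
    | succ k ih =>
      rw [Function.iterate_succ_apply']
      rcases ih with h | h
      · right; rw [h, hta]
      · left; rw [h, htb]
  rcases key n with h | h
  · exact ha (h.symm.trans hn)
  · exact hb (h.symm.trans hn)

lemma weight_p {X : Type*} [Fintype X] (r : X × X → ℝ) (a b : X) (p m : ℝ)
    (x : X) (t : X → X) (ha : a ≠ x) (hta : t a = b) (hn : ¬ (b ≠ x ∧ t b = a)) :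
    treeWeight (ratePM r a b p m) x t =
      p * ∏ y ∈ (Finset.univ.filter (fun y => y ≠ x)).erase a, ratePM r a b 0 0 (y, t y) := by
  unfold treeWeight
  rw [← Finset.mul_prod_erase _ _ (show a ∈ Finset.univ.filter (fun y => y ≠ x) by simp [ha])]
  congr 1
  · simp [ratePM, hta]
  · apply Finset.prod_congr rfl
    intro y hy
    simp only [Finset.mem_erase, Finset.mem_filter, Finset.mem_univ, true_and] at hy
    have h1 : (y, t y) ≠ (a, b) := fun h => hy.1 (Prod.mk.inj h).1
    have h2 : (y, t y) ≠ (b, a) := by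
      intro h
      obtain ⟨e1, e2⟩ := Prod.mk.inj h
      subst e1
      exact hn ⟨hy.2, e2⟩
    rw [ratePM_off _ _ _ _ _ _ h1 h2, ratePM_off _ _ _ _ _ _ h1 h2]

lemma weight_none {X : Type*} [Fintype X] (r : X × X → ℝ) (a b : X) (p m : ℝ)
    (x : X) (t : X → X) (hn1 : ¬ (a ≠ x ∧ t a = b)) (hn : ¬ (b ≠ x ∧ t b = a)) :
    treeWeight (ratePM r a b p m) x t = treeWeight (ratePM r a b 0 0) x t := by
  unfold treeWeight
  apply Finset.prod_congr rfl
  intro y hy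
  simp only [Finset.mem_filter, Finset.mem_univ, true_and] at hy
  have h1 : (y, t y) ≠ (a, b) := by
    intro h
    obtain ⟨e1, e2⟩ := Prod.mk.inj h
    subst e1
    exact hn1 ⟨hy, e2⟩
  have h2 : (y, t y) ≠ (b, a) := by
    intro h
    obtain ⟨e1, e2⟩ := Prod.mk.inj h
    subst e1
    exact hn ⟨hy, e2⟩
  rw [ratePM_off _ _ _ _ _ _ h1 h2, ratePM_off _ _ _ _ _ _ h1 h2]

lemma weight_nonneg {X : Type*} [Fintype X] (r : X × X → ℝ) (hr : ∀ e, 0 ≤ r e)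
    (x : X) (t : X → X) : 0 ≤ treeWeight r x t :=
  Finset.prod_nonneg fun _ _ => hr _

lemma term_affine {X : Type*} [Fintype X] (r : X × X → ℝ) (a b : X) (hab : a ≠ b)
    (hr : ∀ e, e ≠ (a, b) → e ≠ (b, a) → 0 ≤ r e) (x : X) (t : X → X) :
    ∃ cp cm : ℝ, 0 ≤ cp ∧ 0 ≤ cm ∧ ∀ p m : ℝ,
      (if IsRootedTree x t ∧ treeEdges x t ∩ ∅ = ∅ ∧ ∅ ⊆ treeEdges x t
        then treeWeight (ratePM r a b p m) x t else 0) =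
      (if IsRootedTree x t ∧ treeEdges x t ∩ ∅ = ∅ ∧ ∅ ⊆ treeEdges x t
        then treeWeight (ratePM r a b 0 0) x t else 0) + cp * p + cm * m := by
  have hnn := ratePM_nonneg r a b hr
  by_cases ht : IsRootedTree x t
  · simp only [ht, Set.inter_empty, Set.empty_subset, and_self, if_true]
    by_cases h1 : a ≠ x ∧ t a = b
    · have h2 := not_both a b hab x t ht h1.1 h1.2
      refine ⟨∏ y ∈ (Finset.univ.filter (fun y => y ≠ x)).erase a, ratePM r a b 0 0 (y, t y), 0, Finset.prod_nonneg fun y _ => hnn (y, t y), le_rfl, fun p m => ?_⟩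
      · rw [weight_p r a b p m x t h1.1 h1.2 h2, weight_p r a b 0 0 x t h1.1 h1.2 h2]
        ring
    · by_cases h2 : b ≠ x ∧ t b = a
      · refine ⟨0, ∏ y ∈ (Finset.univ.filter (fun y => y ≠ x)).erase b, ratePM r a b 0 0 (y, t y), le_rfl, Finset.prod_nonneg fun y _ => hnn (y, t y), fun p m => ?_⟩
        · rw [ratePM_swap r a b hab p m, ratePM_swap r a b hab 0 0,
            weight_p r b a m p x t h2.1 h2.2 h1, weight_p r b a 0 0 x t h2.1 h2.2 h1]
          ring
      · refine ⟨0, 0, le_rfl, le_rfl, fun p m => ?_⟩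
        rw [weight_none r a b p m x t h1 h2]
        ring
  · exact ⟨0, 0, le_rfl, le_rfl, fun p m => by simp [ht]⟩

lemma tau_affine {X : Type*} [Fintype X] (r : X × X → ℝ) (a b : X) (hab : a ≠ b)
    (hr : ∀ e, e ≠ (a, b) → e ≠ (b, a) → 0 ≤ r e) (x : X) :
    ∃ cp cm : ℝ, 0 ≤ cp ∧ 0 ≤ cm ∧ ∀ p m : ℝ,
      tau (ratePM r a b p m) x ∅ ∅ = tau (ratePM r a b 0 0) x ∅ ∅ + cp * p + cm * m := by
  choose cp cm h1 h2 h3 using fun t : X → X => term_affine r a b hab hr x t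
  refine ⟨∑ t, cp t, ∑ t, cm t, Finset.sum_nonneg fun t _ => h1 t,
    Finset.sum_nonneg fun t _ => h2 t, fun p m => ?_⟩
  unfold tau
  rw [Finset.sum_mul, Finset.sum_mul, ← Finset.sum_add_distrib, ← Finset.sum_add_distrib]
  exact Finset.sum_congr rfl fun t _ => h3 t p m

/-- Trees rooted at `a` using the edge `(b,a)`, with that edge's factor removed. -/
def tauC {X : Type*} [Fintype X] (r : X × X → ℝ) (a b : X) : ℝ :=
  ∑ t ∈ Finset.univ.filter (fun t : X → X => IsRootedTree a t ∧ t b = a),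
    ∏ y ∈ (Finset.univ.filter (fun y => y ≠ a)).erase b, ratePM r a b 0 0 (y, t y)

lemma tau_root {X : Type*} [Fintype X] (r : X × X → ℝ) (a b : X) (hab : a ≠ b) (p m : ℝ) :
    tau (ratePM r a b p m) a ∅ ∅ =
      tau (ratePM r a b 0 0) a {(a, b), (b, a)} ∅ + m * tauC r a b := by
  unfold tau tauC
  rw [Finset.sum_filter, Finset.mul_sum, ← Finset.sum_add_distrib]
  apply Finset.sum_congr rfl
  intro t _
  by_cases ht : IsRootedTree a t
  · by_cases htb : t b = a
    · have h : treeEdges a t ∩ {(a, b), (b, a)} ≠ ∅ := by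
        apply Set.Nonempty.ne_empty
        exact ⟨(b, a), ⟨hab.symm, htb.symm⟩, by simp⟩
      simp only [ht, htb, h, Set.inter_empty, Set.empty_subset, and_self, if_true, false_and,
        and_false, if_false, zero_add]
      rw [ratePM_swap r a b hab p m, weight_p r b a m p a t hab.symm htb (fun h => h.1 rfl),
        ratePM_swap r b a hab.symm 0 0]
    · have h : treeEdges a t ∩ {(a, b), (b, a)} = ∅ := by
        apply Set.eq_empty_of_forall_notMem
        rintro ⟨y, z⟩ ⟨⟨h1, h2⟩, h3⟩
        simp only [Set.mem_insert_iff, Set.mem_singleton_iff, Prod.mk.injEq] at h1 h2 h3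
        rcases h3 with h3 | h3
        · exact h1 h3.1
        · apply htb
          rw [← h3.1, ← h2, h3.2]
      simp only [ht, htb, h, Set.inter_empty, Set.empty_subset, and_self, if_true, and_false,
        if_false, mul_zero, add_zero]
      exact weight_none r a b p m a t (fun h => h.1 rfl) (fun h => htb h.2)
  · simp [ht]

/-- Re-root along the edge between `a` and `b`: new root `b`. -/
def reroot {X : Type*} (a b : X) (t : X → X) : X → X :=
  fun y => if y = a then b else if y = b then b else t y

lemma reroot_tree {X : Type*} (a b : X) (t : X → X)
    (ht : IsRootedTree a t) : IsRootedTree b (reroot a b t) := by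
  refine ⟨by simp [reroot], fun y => ?_⟩
  obtain ⟨n, hn⟩ := ht.2 y
  induction n generalizing y with
  | zero =>
    refine ⟨1, ?_⟩
    have : y = a := hn
    simp [reroot, this]
  | succ k ih =>
    by_cases h1 : y = a
    · exact ⟨1, by simp [reroot, h1]⟩
    · by_cases h2 : y = b
      · exact ⟨0, h2⟩
      · obtain ⟨j, hj⟩ := ih (t y) hn
        refine ⟨j + 1, ?_⟩
        rw [Function.iterate_succ_apply]
        have : reroot a b t y = t y := by simp [reroot, h1, h2]
        rw [this, hj]

lemma reroot_reroot {X : Type*} (a b : X) (hab : a ≠ b) (t : X → X)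
    (hta : t a = a) (htb : t b = a) : reroot b a (reroot a b t) = t := by
  funext y
  unfold reroot
  by_cases h1 : y = a
  · subst h1; simp [hab, hta]
  · by_cases h2 : y = b
    · subst h2; simp [htb]
    · simp [h1, h2]

lemma tauC_symm {X : Type*} [Fintype X] (r : X × X → ℝ) (a b : X) (hab : a ≠ b) :
    tauC r a b = tauC r b a := by
  unfold tauC
  refine Finset.sum_bij' (fun t _ => reroot a b t) (fun t _ => reroot b a t) ?_ ?_ ?_ ?_ ?_
  · intro t ht
    simp only [Finset.mem_filter, Finset.mem_univ, true_and] at ht ⊢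
    exact ⟨reroot_tree a b t ht.1, by simp [reroot]⟩
  · intro t ht
    simp only [Finset.mem_filter, Finset.mem_univ, true_and] at ht ⊢
    exact ⟨reroot_tree b a t ht.1, by simp [reroot]⟩
  · intro t ht
    simp only [Finset.mem_filter, Finset.mem_univ, true_and] at ht
    exact reroot_reroot a b hab t ht.1.1 ht.2
  · intro t ht
    simp only [Finset.mem_filter, Finset.mem_univ, true_and] at ht
    exact reroot_reroot b a hab.symm t ht.1.1 ht.2
  · intro t _
    rw [ratePM_swap r b a hab.symm 0 0]
    apply Finset.prod_congr
    · ext y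
      simp [and_comm]
    · intro y hy
      simp only [Finset.mem_erase, Finset.mem_filter, Finset.mem_univ, true_and] at hy
      simp [reroot, hy.1, hy.2]

lemma exists_pos_tree {X : Type*} (r : X × X → ℝ) (h : Irreducible' r) (a : X) :
    ∃ t : X → X, IsRootedTree a t ∧ ∀ y, y ≠ a → 0 < r (y, t y) := by
  have hex : ∀ y : X, ∃ n : ℕ, ∃ f : ℕ → X,
      f 0 = y ∧ f n = a ∧ ∀ i < n, 0 < r (f i, f (i + 1)) := by
    intro y
    by_cases hy : y = a
    · exact ⟨0, fun _ => a, hy.symm, rfl, fun i hi => absurd hi (Nat.not_lt_zero i)⟩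
    · exact h y a hy
  have hstep : ∀ y : X, ∃ z : X,
      (y = a → z = a) ∧ (y ≠ a → 0 < r (y, z) ∧ Nat.find (hex z) < Nat.find (hex y)) := by
    intro y
    by_cases hy : y = a
    · exact ⟨a, fun _ => rfl, fun h => absurd hy h⟩
    · obtain ⟨f, h0, h1, h2⟩ := Nat.find_spec (hex y)
      have hpos : 0 < Nat.find (hex y) := by
        rcases Nat.eq_zero_or_pos (Nat.find (hex y)) with h | h
        · rw [h] at h1
          exact absurd (h0.symm.trans h1) hy
        · exact h
      refine ⟨f 1, fun h => absurd h hy, fun _ => ⟨?_, ?_⟩⟩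
      · have := h2 0 hpos
        rwa [h0] at this
      · have : Nat.find (hex (f 1)) ≤ Nat.find (hex y) - 1 := by
          apply Nat.find_min'
          refine ⟨fun i => f (i + 1), rfl, ?_, fun i hi => h2 (i + 1) (by omega)⟩
          show f (Nat.find (hex y) - 1 + 1) = a
          rw [Nat.sub_add_cancel hpos]
          exact h1
        omega
  choose t ht1 ht2 using hstep
  refine ⟨t, ⟨ht1 a rfl, ?_⟩, fun y hy => (ht2 y hy).1⟩
  have key : ∀ N : ℕ, ∀ y, Nat.find (hex y) < N → ∃ n : ℕ, t^[n] y = a := by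
    intro N
    induction N with
    | zero => intro y hy; omega
    | succ k ih =>
      intro y hy
      by_cases hya : y = a
      · exact ⟨0, hya⟩
      · obtain ⟨n, hn⟩ := ih (t y) (by have := (ht2 y hya).2; omega)
        exact ⟨n + 1, hn⟩
  exact fun y => key _ y (Nat.lt_succ_self _)

lemma tau_nonneg {X : Type*} [Fintype X] (r : X × X → ℝ) (hr : ∀ e, 0 ≤ r e)
    (x : X) (A B : Set (X × X)) : 0 ≤ tau r x A B := by
  apply Finset.sum_nonneg
  intro t _
  split_ifs
  · exact weight_nonneg r hr x t
  · exact le_rfl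

lemma tau_pos {X : Type*} [Fintype X] (r : X × X → ℝ) (hr : ∀ e, 0 ≤ r e)
    (h : Irreducible' r) (x : X) : 0 < tau r x ∅ ∅ := by
  obtain ⟨t, ht, hp⟩ := exists_pos_tree r h x
  apply Finset.sum_pos'
  · intro t _
    split_ifs
    · exact weight_nonneg r hr x t
    · exact le_rfl
  · refine ⟨t, Finset.mem_univ _, ?_⟩
    simp only [ht, Set.inter_empty, Set.empty_subset, and_self, if_true]
    apply Finset.prod_pos
    intro y hy
    simp only [Finset.mem_filter, Finset.mem_univ, true_and] at hy
    exact hp y hy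

lemma num_ab {X : Type*} [Fintype X] (r : X × X → ℝ) (a b : X) (hab : a ≠ b) (p m : ℝ) :
    ratePM r a b p m (a, b) * tau (ratePM r a b p m) a ∅ ∅
      - ratePM r a b p m (b, a) * tau (ratePM r a b p m) b ∅ ∅ =
    tau (ratePM r a b 0 0) a {(a, b), (b, a)} ∅ * p
      + (-(tau (ratePM r a b 0 0) b {(a, b), (b, a)} ∅)) * m := by
  have e1 : ratePM r a b p m (a, b) = p := by simp [ratePM]
  have e2 : ratePM r a b p m (b, a) = m := by simp [ratePM, hab, hab.symm]
  have hA := tau_root r a b hab p m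
  have hB := tau_root r b a hab.symm m p
  rw [← ratePM_swap r a b hab p m, ← ratePM_swap r a b hab 0 0, Set.pair_comm,
    ← tauC_symm r a b hab] at hB
  rw [e1, e2, hA, hB]
  ring

theorem stmt_17 {X : Type*} [Fintype X] (r : X × X → ℝ) (a b : X) (hab : a ≠ b)
    (hr : ∀ e, e ≠ (a, b) → e ≠ (b, a) → 0 ≤ r e)
    (hirr : Irreducible' (ratePM r a b 0 0))
    (u v : X) (huv : u ≠ v) :
    (∃ n₀ np nm d₀ dp dm : ℝ, 0 < d₀ ∧ 0 ≤ dp ∧ 0 ≤ dm ∧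
      ∀ p m : ℝ, 0 ≤ p → 0 ≤ m →
        current (ratePM r a b p m) u v =
          (n₀ + np * p + nm * m) / (d₀ + dp * p + dm * m)) ∧
    (∃ d₀ dp dm : ℝ, 0 < d₀ ∧ 0 ≤ dp ∧ 0 ≤ dm ∧
      ∀ p m : ℝ, 0 ≤ p → 0 ≤ m →
        current (ratePM r a b p m) a b =
          (tau (ratePM r a b 0 0) a {(a, b), (b, a)} ∅ * p
            + (-(tau (ratePM r a b 0 0) b {(a, b), (b, a)} ∅)) * m)
            / (d₀ + dp * p + dm * m)) := by
  have hnn := ratePM_nonneg r a b hr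
  choose cp cm h1 h2 h3 using fun x : X => tau_affine r a b hab hr x
  have hD : ∀ p m : ℝ, ∑ x, tau (ratePM r a b p m) x ∅ ∅ =
      ∑ x, tau (ratePM r a b 0 0) x ∅ ∅ + (∑ x, cp x) * p + (∑ x, cm x) * m := by
    intro p m
    rw [Finset.sum_mul, Finset.sum_mul, ← Finset.sum_add_distrib, ← Finset.sum_add_distrib]
    exact Finset.sum_congr rfl fun x _ => h3 x p m
  have hd0 : 0 < ∑ x, tau (ratePM r a b 0 0) x ∅ ∅ :=
    Finset.sum_pos (fun x _ => tau_pos _ hnn hirr x) ⟨a, Finset.mem_univ a⟩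
  have hdp : 0 ≤ ∑ x, cp x := Finset.sum_nonneg fun x _ => h1 x
  have hdm : 0 ≤ ∑ x, cm x := Finset.sum_nonneg fun x _ => h2 x
  constructor
  · have hnum : ∃ n₀ np nm : ℝ, ∀ p m : ℝ,
        ratePM r a b p m (u, v) * tau (ratePM r a b p m) u ∅ ∅
          - ratePM r a b p m (v, u) * tau (ratePM r a b p m) v ∅ ∅ = n₀ + np * p + nm * m := by
      by_cases hc1 : u = a ∧ v = b
      · obtain ⟨rfl, rfl⟩ := hc1
        refine ⟨0, tau (ratePM r u v 0 0) u {(u, v), (v, u)} ∅,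
          -tau (ratePM r u v 0 0) v {(u, v), (v, u)} ∅, fun p m => ?_⟩
        rw [num_ab r u v hab p m, zero_add]
      · by_cases hc2 : u = b ∧ v = a
        · obtain ⟨rfl, rfl⟩ := hc2
          refine ⟨0, -tau (ratePM r v u 0 0) v {(v, u), (u, v)} ∅,
            tau (ratePM r v u 0 0) u {(v, u), (u, v)} ∅, fun p m => ?_⟩
          have := num_ab r v u hab p m
          linarith
        · have q1 : (u, v) ≠ (a, b) := fun h => hc1 (Prod.mk.inj h)
          have q2 : (u, v) ≠ (b, a) := fun h => hc2 (Prod.mk.inj h)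
          have q3 : (v, u) ≠ (a, b) := fun h => hc2 (Prod.mk.inj h).symm
          have q4 : (v, u) ≠ (b, a) := fun h => hc1 (Prod.mk.inj h).symm
          refine ⟨r (u, v) * tau (ratePM r a b 0 0) u ∅ ∅
              - r (v, u) * tau (ratePM r a b 0 0) v ∅ ∅,
            r (u, v) * cp u - r (v, u) * cp v, r (u, v) * cm u - r (v, u) * cm v,
            fun p m => ?_⟩
          rw [ratePM_off r a b p m _ q1 q2, ratePM_off r a b p m _ q3 q4, h3 u p m, h3 v p m]
          ring
    obtain ⟨n₀, np, nm, hn⟩ := hnum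
    refine ⟨n₀, np, nm, _, _, _, hd0, hdp, hdm, fun p m _ _ => ?_⟩
    unfold current
    rw [hn p m, hD p m]
  · refine ⟨_, _, _, hd0, hdp, hdm, fun p m _ _ => ?_⟩
    unfold current
    rw [num_ab r a b hab p m, hD p m]
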